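/- Suppose (U'₁,U'₂,<') is the result of applying a case II coherent extended Nielsen transformation to a coherent extended word equation (U₁,U₂,<). If the cut graph G_{U₁,U₂,<} is acyclic, then so is the cut graph G_{U'₁,U'₂,<'}. -/

import Mathlib

open scoped Classical

namespace ExtWordEq

/-- The type of (candidate) boundary orders: relations on pairs (i,j). -/
abbrev BRel : Type := ℕ × ℕ → ℕ × ℕ → Prop

variable {X : Type*}

/-- The `i`-th side of the word equation (`i = 1` gives `U₁`, anything else `U₂`). -/
def word (U₁ U₂ : List X) (i : ℕ) : List X := if i = 1 then U₁ else U₂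

/-- The variable `U_{i,j}` (1-indexed), as an optional value. -/
def letter (U₁ U₂ : List X) (b : ℕ × ℕ) : Option X := (word U₁ U₂ b.1)[b.2 - 1]?

/-- `b` is a boundary of the word equation `(U₁, U₂)`. -/
def Boundary (U₁ U₂ : List X) (b : ℕ × ℕ) : Prop :=
  (b.1 = 1 ∨ b.1 = 2) ∧ 1 ≤ b.2 ∧ b.2 ≤ (word U₁ U₂ b.1).length

/-- `b` is a boundary of `(U₁, U₂)` or one of the conventional boundaries `(1,0)`, `(2,0)`. -/
def EBoundary (U₁ U₂ : List X) (b : ℕ × ℕ) : Prop :=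
  (b.1 = 1 ∨ b.1 = 2) ∧ b.2 ≤ (word U₁ U₂ b.1).length

/-- Incomparability `a ≈ b` for a strict order. -/
def Incomp (lt : BRel) (a b : ℕ × ℕ) : Prop := ¬ lt a b ∧ ¬ lt b a

/-- `lt` is a boundary order for the word equation `(U₁, U₂)`:
a strict weak order on the boundaries (together with the conventional boundaries
`(1,0) ≈ (2,0)`), extending `(i,j) < (i,j+1)` and with `(1,m) ≈ (2,n)`. -/
structure BoundaryOrder (U₁ U₂ : List X) (lt : BRel) : Prop where
  irrefl : ∀ a, EBoundary U₁ U₂ a → ¬ lt a a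
  trans : ∀ a b c, EBoundary U₁ U₂ a → EBoundary U₁ U₂ b → EBoundary U₁ U₂ c →
    lt a b → lt b c → lt a c
  incomp_trans : ∀ a b c, EBoundary U₁ U₂ a → EBoundary U₁ U₂ b → EBoundary U₁ U₂ c →
    Incomp lt a b → Incomp lt b c → Incomp lt a c
  succ : ∀ i j : ℕ, EBoundary U₁ U₂ (i, j + 1) → lt (i, j) (i, j + 1)
  top : Incomp lt (1, U₁.length) (2, U₂.length)
  bot : Incomp lt (1, 0) (2, 0)

/-- `L(U_{i,1} U_{i,2} ⋯ U_{i,j})` where `L` is the additive extension of a length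
assignment on variables. -/
def prefixLen (U₁ U₂ : List X) (L : X → ℕ) (b : ℕ × ℕ) : ℕ :=
  (((word U₁ U₂ b.1).take b.2).map L).sum

/-- The extended word equation `(U₁, U₂, lt)` is coherent. -/
def Coherent (U₁ U₂ : List X) (lt : BRel) : Prop :=
  ∃ L : X → ℕ, (∀ x, 0 < L x) ∧
    ∀ a b, Boundary U₁ U₂ a → Boundary U₁ U₂ b →
      (lt a b ↔ prefixLen U₁ U₂ L a < prefixLen U₁ U₂ L b)

/-- The boundary `a` cuts the boundary `b`. -/
def Cuts (U₁ U₂ : List X) (lt : BRel) (a b : ℕ × ℕ) : Prop :=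
  Boundary U₁ U₂ a ∧ Boundary U₁ U₂ b ∧ a ≠ b ∧
    lt (a.1, a.2 - 1) b ∧ lt (b.1, b.2 - 1) a

/-- The boundary `a` mirrors the boundary `b`. -/
def Mirrors (U₁ U₂ : List X) (lt : BRel) (a b : ℕ × ℕ) : Prop :=
  Boundary U₁ U₂ a ∧ Boundary U₁ U₂ b ∧ letter U₁ U₂ a = letter U₁ U₂ b ∧
    (¬ Incomp lt a b ∨ ¬ Incomp lt (a.1, a.2 - 1) (b.1, b.2 - 1))

/-- Edge relation of the cut graph `G_{U₁,U₂,<}`. -/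
def CutEdge (U₁ U₂ : List X) (lt : BRel) (a b : ℕ × ℕ) : Prop :=
  ∃ c, Cuts U₁ U₂ lt a c ∧ Mirrors U₁ U₂ lt c b

/-- `w 0, w 1, …, w n` is a cycle (of length `n ≥ 1`) in the cut graph. -/
def IsCycle (U₁ U₂ : List X) (lt : BRel) (n : ℕ) (w : ℕ → ℕ × ℕ) : Prop :=
  0 < n ∧ w n = w 0 ∧ ∀ k < n, CutEdge U₁ U₂ lt (w k) (w (k + 1))

/-- The cut graph `G_{U₁,U₂,<}` is acyclic. -/
def Acyclic (U₁ U₂ : List X) (lt : BRel) : Prop :=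
  ¬ ∃ n w, IsCycle U₁ U₂ lt n w

variable [DecidableEq X]

/-- Case I extended Nielsen transformation (here `x = U_{1,1}`, `y = U_{2,1}`,
and `T(y) = x`). -/
def NielsenI (U₁ U₂ : List X) (lt : BRel) (U₁' U₂' : List X) (lt' : BRel) : Prop :=
  ∃ x y : X, U₁.head? = some x ∧ U₂.head? = some y ∧
    Incomp lt (1, 1) (2, 1) ∧
    U₁' = (U₁.map fun z => if z = y then x else z).tail ∧
    U₂' = (U₂.map fun z => if z = y then x else z).tail ∧
    BoundaryOrder U₁' U₂' lt' ∧
    ∀ a b : ℕ × ℕ, EBoundary U₁' U₂' a → EBoundary U₁' U₂' b →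
      (lt' a b ↔ lt (a.1, a.2 + 1) (b.1, b.2 + 1))

/-- The substitution `T(x) = y x` (identity on other variables), applied to a word. -/
def expand (x y : X) (l : List X) : List X :=
  l.flatMap fun z => if z = x then [y, x] else [z]

/-- The map `μ(i,j) = j + #{j' ≤ j : U_{i,j'} = x} − 1` (as a map on boundaries),
where `x = U_{1,1}`. -/
def mu (U₁ U₂ : List X) (x : X) (b : ℕ × ℕ) : ℕ × ℕ :=
  (b.1, b.2 + ((word U₁ U₂ b.1).take b.2).count x - 1)

/-- The map `ν(i,j) = j − #{j' ≤ j : U'_{i,j'} = x} + 1` (as a map on boundaries),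
where `x = U_{1,1}`. -/
def nu (U₁' U₂' : List X) (x : X) (b : ℕ × ℕ) : ℕ × ℕ :=
  (b.1, b.2 - ((word U₁' U₂' b.1).take b.2).count x + 1)

/-- Membership in `B⁻ = B ∖ {(2,1)}`. -/
def Bminus (U₁ U₂ : List X) (b : ℕ × ℕ) : Prop := Boundary U₁ U₂ b ∧ b ≠ (2, 1)

/-- Membership in `B'⁻ = {(i, μ(i,j)) : (i,j) ∈ B⁻}` (`x = U_{1,1}`). -/
def Bpminus (U₁ U₂ : List X) (x : X) (b' : ℕ × ℕ) : Prop :=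
  ∃ b, Bminus U₁ U₂ b ∧ mu U₁ U₂ x b = b'

/-- Case II extended Nielsen transformation, with the heads `x = U_{1,1}`,
`y = U_{2,1}` made explicit. -/
def NielsenIIxy (U₁ U₂ : List X) (lt : BRel) (U₁' U₂' : List X) (lt' : BRel)
    (x y : X) : Prop :=
  U₁.head? = some x ∧ U₂.head? = some y ∧
  lt (2, 1) (1, 1) ∧
  U₁' = (expand x y U₁).tail ∧
  U₂' = (expand x y U₂).tail ∧
  BoundaryOrder U₁' U₂' lt' ∧
  ∀ a b, Bpminus U₁ U₂ x a → Bpminus U₁ U₂ x b →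
    (lt' a b ↔ lt (nu U₁' U₂' x a) (nu U₁' U₂' x b))

/-- Case II extended Nielsen transformation. -/
def NielsenII (U₁ U₂ : List X) (lt : BRel) (U₁' U₂' : List X) (lt' : BRel) : Prop :=
  ∃ x y : X, NielsenIIxy U₁ U₂ lt U₁' U₂' lt' x y

/-- The dual boundary order. -/
def dualRel (lt : BRel) : BRel := fun a b => lt (3 - a.1, a.2) (3 - b.1, b.2)

/-- Case III extended Nielsen transformation: case II applied to the dual,
then dualized back. -/
def NielsenIII (U₁ U₂ : List X) (lt : BRel) (U₁' U₂' : List X) (lt' : BRel) : Prop :=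
  NielsenII U₂ U₁ (dualRel lt) U₂' U₁' (dualRel lt')

/-- `(U₁', U₂', lt')` is an extended Nielsen transformation of the nontrivial coherent
extended word equation `(U₁, U₂, lt)`. -/
def ExtNielsen (U₁ U₂ : List X) (lt : BRel) (U₁' U₂' : List X) (lt' : BRel) : Prop :=
  U₁ ≠ [] ∧ U₂ ≠ [] ∧ BoundaryOrder U₁ U₂ lt ∧ Coherent U₁ U₂ lt ∧
    (NielsenI U₁ U₂ lt U₁' U₂' lt' ∨ NielsenII U₁ U₂ lt U₁' U₂' lt' ∨
      NielsenIII U₁ U₂ lt U₁' U₂' lt')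

/-- A coherent extended Nielsen transformation. -/
def CohNielsen (U₁ U₂ : List X) (lt : BRel) (U₁' U₂' : List X) (lt' : BRel) : Prop :=
  ExtNielsen U₁ U₂ lt U₁' U₂' lt' ∧ Coherent U₁' U₂' lt'

/-- `(U₁, U₂, lt)` is (strongly) terminating: there is no infinite sequence of coherent
extended Nielsen transformations starting from it. -/
def Terminating (U₁ U₂ : List X) (lt : BRel) : Prop :=
  ¬ ∃ f : ℕ → List X × List X × BRel,
    f 0 = (U₁, U₂, lt) ∧
    ∀ n, CohNielsen (f n).1 (f n).2.1 (f n).2.2 (f (n + 1)).1 (f (n + 1)).2.1 (f (n + 1)).2.2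


section Prefix

variable {Y : Type*}

/-- The boundary order `lt` compares prefix lengths with respect to `L`, including at the
conventional boundaries `(1,0)` and `(2,0)`. -/
def Measures (U₁ U₂ : List Y) (lt : BRel) (L : Y → ℕ) : Prop :=
  ∀ a b, EBoundary U₁ U₂ a → EBoundary U₁ U₂ b →
    (lt a b ↔ prefixLen U₁ U₂ L a < prefixLen U₁ U₂ L b)

theorem Boundary.eBoundary {U₁ U₂ : List Y} {b : ℕ × ℕ} (h : Boundary U₁ U₂ b) :
    EBoundary U₁ U₂ b := ⟨h.1, h.2.2⟩

theorem Boundary.eBoundary_pred {U₁ U₂ : List Y} {b : ℕ × ℕ} (h : Boundary U₁ U₂ b) :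
    EBoundary U₁ U₂ (b.1, b.2 - 1) := ⟨h.1, (Nat.sub_le _ _).trans h.2.2⟩

theorem prefixLen_mono (U₁ U₂ : List Y) (L : Y → ℕ) (i : ℕ) {j k : ℕ} (h : j ≤ k) :
    prefixLen U₁ U₂ L (i, j) ≤ prefixLen U₁ U₂ L (i, k) := by
  obtain ⟨d, rfl⟩ := Nat.exists_eq_add_of_le h
  simp [prefixLen, List.take_add]

theorem Boundary.prefixLen_eq {U₁ U₂ : List Y} {b : ℕ × ℕ} (h : Boundary U₁ U₂ b) (L : Y → ℕ)
    {z : Y} (hz : letter U₁ U₂ b = some z) :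
    prefixLen U₁ U₂ L b = prefixLen U₁ U₂ L (b.1, b.2 - 1) + L z := by
  obtain ⟨i, j⟩ := b
  obtain ⟨-, h1, h2⟩ := h
  obtain ⟨j, rfl⟩ : ∃ k, j = k + 1 := ⟨j - 1, by simp at h1; omega⟩
  simp only [letter, Nat.add_sub_cancel] at hz
  simp [prefixLen, List.take_add_one, hz]

theorem Boundary.exists_letter {U₁ U₂ : List Y} {b : ℕ × ℕ} (h : Boundary U₁ U₂ b) :
    ∃ z, letter U₁ U₂ b = some z := by
  obtain ⟨-, h1, h2⟩ := h
  exact ⟨_, List.getElem?_eq_getElem (by omega)⟩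

theorem Boundary.prefixLen_pos {U₁ U₂ : List Y} {b : ℕ × ℕ} (h : Boundary U₁ U₂ b) {L : Y → ℕ}
    (hL : ∀ x, 0 < L x) : 0 < prefixLen U₁ U₂ L b := by
  obtain ⟨z, hz⟩ := h.exists_letter
  have := h.prefixLen_eq L hz
  have := hL z
  omega

theorem prefixLen_zero (U₁ U₂ : List Y) (L : Y → ℕ) (i : ℕ) : prefixLen U₁ U₂ L (i, 0) = 0 := by
  simp [prefixLen]

theorem BoundaryOrder.incomp_zero {U₁ U₂ : List Y} {lt : BRel} (h : BoundaryOrder U₁ U₂ lt)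
    {i k : ℕ} (hi : i = 1 ∨ i = 2) (hk : k = 1 ∨ k = 2) : Incomp lt (i, 0) (k, 0) := by
  rcases hi with rfl | rfl <;> rcases hk with rfl | rfl
  · exact ⟨h.irrefl _ ⟨Or.inl rfl, Nat.zero_le _⟩, h.irrefl _ ⟨Or.inl rfl, Nat.zero_le _⟩⟩
  · exact h.bot
  · exact h.bot.symm
  · exact ⟨h.irrefl _ ⟨Or.inr rfl, Nat.zero_le _⟩, h.irrefl _ ⟨Or.inr rfl, Nat.zero_le _⟩⟩

theorem BoundaryOrder.zero_lt_same {U₁ U₂ : List Y} {lt : BRel} (h : BoundaryOrder U₁ U₂ lt)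
    (i j : ℕ) (hb : EBoundary U₁ U₂ (i, j + 1)) : lt (i, 0) (i, j + 1) := by
  induction j with
  | zero => exact h.succ _ _ hb
  | succ j ih =>
    have hj : EBoundary U₁ U₂ (i, j + 1) := ⟨hb.1, (Nat.le_succ _).trans hb.2⟩
    exact h.trans _ _ _ ⟨hb.1, Nat.zero_le _⟩ hj hb (ih hj) (h.succ _ _ hb)

theorem BoundaryOrder.zero_lt {U₁ U₂ : List Y} {lt : BRel} (h : BoundaryOrder U₁ U₂ lt)
    {i : ℕ} (hi : i = 1 ∨ i = 2) {b : ℕ × ℕ} (hb : Boundary U₁ U₂ b) : lt (i, 0) b := by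
  obtain ⟨k, j⟩ := b
  obtain ⟨j, rfl⟩ : ∃ m, j = m + 1 := ⟨j - 1, by have := hb.2.1; simp at this; omega⟩
  have hi0 : EBoundary U₁ U₂ (i, 0) := ⟨hi, Nat.zero_le _⟩
  have hk0 : EBoundary U₁ U₂ (k, 0) := ⟨hb.1, Nat.zero_le _⟩
  have hlt := h.zero_lt_same k j hb.eBoundary
  have hinc := h.incomp_zero hb.1 hi
  by_contra hn
  by_cases hr : lt (k, j + 1) (i, 0)
  · exact hinc.1 (h.trans _ _ _ hk0 hb.eBoundary hi0 hlt hr)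
  · exact (h.incomp_trans _ _ _ hk0 hi0 hb.eBoundary hinc ⟨hn, hr⟩).1 hlt

theorem BoundaryOrder.measures {U₁ U₂ : List Y} {lt : BRel} (h : BoundaryOrder U₁ U₂ lt)
    {L : Y → ℕ} (hL : ∀ x, 0 < L x)
    (hlt : ∀ a b, Boundary U₁ U₂ a → Boundary U₁ U₂ b →
      (lt a b ↔ prefixLen U₁ U₂ L a < prefixLen U₁ U₂ L b)) : Measures U₁ U₂ lt L := by
  have key : ∀ a, EBoundary U₁ U₂ a → Boundary U₁ U₂ a ∨ a = (a.1, 0) := by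
    rintro ⟨i, j⟩ ⟨hi, hj⟩
    rcases Nat.eq_zero_or_pos j with rfl | h0
    · exact Or.inr rfl
    · exact Or.inl ⟨hi, h0, hj⟩
  intro a b ha hb
  rcases key a ha with ha' | ha' <;> rcases key b hb with hb' | hb'
  · exact hlt a b ha' hb'
  · rw [hb', prefixLen_zero]
    refine iff_of_false (fun hab => ?_) (Nat.not_lt_zero _)
    have hb0 : EBoundary U₁ U₂ (b.1, 0) := ⟨hb.1, Nat.zero_le _⟩
    exact h.irrefl _ hb0 (h.trans _ _ _ hb0 ha hb0 (h.zero_lt hb.1 ha') hab)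
  · rw [ha', prefixLen_zero]
    exact iff_of_true (h.zero_lt ha.1 hb') (hb'.prefixLen_pos hL)
  · rw [ha', hb', prefixLen_zero, prefixLen_zero]
    exact iff_of_false (h.incomp_zero ha.1 hb.1).1 (Nat.lt_irrefl _)

theorem Measures.incomp_iff {U₁ U₂ : List Y} {lt : BRel} {L : Y → ℕ}
    (h : Measures U₁ U₂ lt L) {a b : ℕ × ℕ} (ha : EBoundary U₁ U₂ a) (hb : EBoundary U₁ U₂ b) :
    Incomp lt a b ↔ prefixLen U₁ U₂ L a = prefixLen U₁ U₂ L b := by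
  rw [Incomp, h a b ha hb, h b a hb ha]
  omega

theorem Measures.mirrors_iff {U₁ U₂ : List Y} {lt : BRel} {L : Y → ℕ}
    (h : Measures U₁ U₂ lt L) {a b : ℕ × ℕ} (ha : Boundary U₁ U₂ a) (hb : Boundary U₁ U₂ b) :
    Mirrors U₁ U₂ lt a b ↔
      letter U₁ U₂ a = letter U₁ U₂ b ∧ prefixLen U₁ U₂ L a ≠ prefixLen U₁ U₂ L b := by
  rw [Mirrors, h.incomp_iff ha.eBoundary hb.eBoundary,
    h.incomp_iff ha.eBoundary_pred hb.eBoundary_pred]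
  refine ⟨fun ⟨_, _, hl, hne⟩ => ⟨hl, ?_⟩, fun ⟨hl, hne⟩ => ⟨ha, hb, hl, Or.inl hne⟩⟩
  obtain ⟨z, hz⟩ := ha.exists_letter
  have h1 := ha.prefixLen_eq L hz
  have h2 := hb.prefixLen_eq L (hl ▸ hz)
  omega

theorem Measures.cuts_iff {U₁ U₂ : List Y} {lt : BRel} {L : Y → ℕ}
    (h : Measures U₁ U₂ lt L) {a b : ℕ × ℕ} (ha : Boundary U₁ U₂ a) (hb : Boundary U₁ U₂ b) :
    Cuts U₁ U₂ lt a b ↔ a.1 ≠ b.1 ∧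
      prefixLen U₁ U₂ L (a.1, a.2 - 1) < prefixLen U₁ U₂ L b ∧
      prefixLen U₁ U₂ L (b.1, b.2 - 1) < prefixLen U₁ U₂ L a := by
  rw [Cuts, h _ b ha.eBoundary_pred hb.eBoundary, h _ a hb.eBoundary_pred ha.eBoundary]
  refine ⟨fun ⟨_, _, hne, h1, h2⟩ => ⟨fun hi => ?_, h1, h2⟩,
    fun ⟨hi, h1, h2⟩ => ⟨ha, hb, fun hab => hi (congrArg Prod.fst hab), h1, h2⟩⟩
  obtain ⟨i, j⟩ := a
  obtain ⟨i', k⟩ := b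
  obtain rfl : i = i' := hi
  have hjk : j ≠ k := fun hjk => hne (hjk ▸ rfl)
  rcases lt_or_gt_of_ne hjk with hlt | hlt
  · exact absurd (prefixLen_mono U₁ U₂ L i (Nat.le_sub_one_of_lt hlt)) (Nat.not_le.2 h2)
  · exact absurd (prefixLen_mono U₁ U₂ L i (Nat.le_sub_one_of_lt hlt)) (Nat.not_le.2 h1)

theorem acyclic_iff_transGen {U₁ U₂ : List Y} {lt : BRel} :
    Acyclic U₁ U₂ lt ↔ ∀ a, ¬ Relation.TransGen (CutEdge U₁ U₂ lt) a a := by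
  have walk : ∀ a b, Relation.TransGen (CutEdge U₁ U₂ lt) a b →
      ∃ (n : ℕ) (w : ℕ → ℕ × ℕ), 0 < n ∧ w 0 = a ∧ w n = b ∧ ∀ k < n, CutEdge U₁ U₂ lt (w k) (w (k + 1)) := by
    intro a b hab
    induction hab with
    | @single b h =>
      refine ⟨1, fun k => if k = 0 then a else b, one_pos, rfl, rfl, fun k hk => ?_⟩
      obtain rfl : k = 0 := by omega
      exact h
    | @tail b c _ h ih =>
      obtain ⟨n, w, hn, h0, hb, hw⟩ := ih
      refine ⟨n + 1, fun k => if k ≤ n then w k else c, n.succ_pos, by simpa, by simp, ?_⟩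
      intro k hk
      rcases Nat.lt_or_eq_of_le (Nat.le_of_lt_succ hk) with hlt | rfl
      · simpa [hlt.le, Nat.succ_le_of_lt hlt] using hw k hlt
      · simpa [hb] using h
  constructor
  · intro hac a haa
    obtain ⟨n, w, hn, h0, hb, hw⟩ := walk a a haa
    exact hac ⟨n, w, hn, hb.trans h0.symm, hw⟩
  · rintro h ⟨n, w, hn, hw0, hw⟩
    have reach : ∀ k, k < n → Relation.TransGen (CutEdge U₁ U₂ lt) (w 0) (w (k + 1)) := by
      intro k
      induction k with
      | zero => exact fun hk => .single (hw 0 hk)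
      | succ k ih => exact fun hk => (ih (by omega)).tail (hw _ hk)
    have := reach (n - 1) (by omega)
    rw [Nat.sub_add_cancel hn, hw0] at this
    exact h _ this

theorem one_one_boundary {x y : Y} {V₁ V₂ : List Y} : Boundary (x :: V₁) (y :: V₂) (1, 1) := by simp [Boundary, word]

theorem two_one_boundary {x y : Y} {V₁ V₂ : List Y} : Boundary (x :: V₁) (y :: V₂) (2, 1) := by simp [Boundary, word]

theorem prefixLen_one_one {x y : Y} {V₁ V₂ : List Y} (L : Y → ℕ) :
    prefixLen (x :: V₁) (y :: V₂) L (1, 1) = L x := by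
  simp [prefixLen, word]

theorem prefixLen_two_one {x y : Y} {V₁ V₂ : List Y} (L : Y → ℕ) :
    prefixLen (x :: V₁) (y :: V₂) L (2, 1) = L y := by
  simp [prefixLen, word]

theorem Bminus.prefixLen_gt {x y : Y} {V₁ V₂ : List Y} {L : Y → ℕ} (hL : ∀ z, 0 < L z) (hyx : L y < L x)
    {b : ℕ × ℕ}
    (hb : Bminus (x :: V₁) (y :: V₂) b) : L y < prefixLen (x :: V₁) (y :: V₂) L b := by
  obtain ⟨hb, hne⟩ := hb
  obtain ⟨i, j⟩ := b
  obtain ⟨hi, hj, -⟩ := id hb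
  simp only at hi hj
  rcases hi with rfl | rfl
  · have := prefixLen_mono (x :: V₁) (y :: V₂) L 1 hj
    rw [prefixLen_one_one] at this
    omega
  · have hj2 : 1 ≤ j - 1 := by
      have : j ≠ 1 := by rintro rfl; exact hne rfl
      omega
    obtain ⟨z, hz⟩ := hb.exists_letter
    have h1 := hb.prefixLen_eq L hz
    have h2 := prefixLen_mono (x :: V₁) (y :: V₂) L 2 hj2
    rw [prefixLen_two_one] at h2
    have := hL z
    simp only at h1
    omega

end Prefix

/-- The lengths before substitution `T(x) = y x`, given the lengths `L` afterwards. -/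
def pullLen (x y : X) (L : X → ℕ) (z : X) : ℕ := if z = x then L y + L x else L z

theorem pullLen_pos {x y : X} {L : X → ℕ} (hL : ∀ z, 0 < L z) (z : X) : 0 < pullLen x y L z := by
  unfold pullLen
  split
  · exact Nat.add_pos_left (hL y) _
  · exact hL z

theorem expand_cons (x y z : X) (l : List X) :
    expand x y (z :: l) = (if z = x then [y, x] else [z]) ++ expand x y l := rfl

theorem expand_append (x y : X) (l r : List X) :
    expand x y (l ++ r) = expand x y l ++ expand x y r := List.flatMap_append

theorem length_expand (x y : X) (l : List X) :
    (expand x y l).length = l.length + l.count x := by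
  induction l with
  | nil => rfl
  | cons z l ih =>
    rw [expand_cons, List.length_append, ih, List.count_cons]
    by_cases hz : z = x
    · simp [hz]; omega
    · simp [hz]; omega

theorem count_expand {x y : X} (hxy : y ≠ x) (l : List X) :
    (expand x y l).count x = l.count x := by
  induction l with
  | nil => rfl
  | cons z l ih =>
    rw [expand_cons, List.count_append, ih, List.count_cons]
    by_cases hz : z = x
    · simp [hz, hxy]; omega
    · simp [hz]

theorem sum_map_expand (x y : X) (L : X → ℕ) (l : List X) :
    ((expand x y l).map L).sum = (l.map (pullLen x y L)).sum := by
  induction l with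
  | nil => rfl
  | cons z l ih =>
    rw [expand_cons, List.map_append, List.sum_append, ih]
    by_cases hz : z = x <;> simp [hz, pullLen]

theorem take_expand (x y : X) (l : List X) {j : ℕ} (hj : j ≤ l.length) :
    (expand x y l).take (j + (l.take j).count x) = expand x y (l.take j) := by
  conv_lhs => rw [← List.take_append_drop j l, expand_append]
  rw [List.take_append_drop]
  exact List.take_left' (by rw [length_expand, List.length_take, min_eq_left hj])

/-- Every letter of `T(l)` lies in the image of a letter of `l`: it is either the last letter of
that image, and equal to the letter of `l`, or it is the `y` in `T(x) = y x`. -/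
theorem exists_parent (x y : X) (L : X → ℕ) (l : List X) (k : ℕ)
    (hk : k < (expand x y l).length) :
    ∃ q < l.length,
      ((l.take q).map (pullLen x y L)).sum ≤ (((expand x y l).take k).map L).sum ∧
      (((expand x y l).take (k + 1)).map L).sum ≤ ((l.take (q + 1)).map (pullLen x y L)).sum ∧
      (((expand x y l)[k]? = l[q]? ∧
          ((l.take (q + 1)).map (pullLen x y L)).sum =
            (((expand x y l).take (k + 1)).map L).sum) ∨
        ((expand x y l)[k]? = some y ∧ l[q]? = some x ∧
          ((l.take q).map (pullLen x y L)).sum = (((expand x y l).take k).map L).sum)) := by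
  induction l generalizing k with
  | nil => simp [expand] at hk
  | cons z l ih =>
    rw [expand_cons] at hk ⊢
    by_cases hz : z = x
    · subst hz
      simp only [if_true, List.cons_append, List.nil_append, List.length_cons] at hk ⊢
      match k, hk with
      | 0, _ => exact ⟨0, by simp, by simp, by simp [pullLen], Or.inr (by simp)⟩
      | 1, _ => exact ⟨0, by simp, by simp, by simp [pullLen], Or.inl (by simp [pullLen])⟩
      | k + 2, hk =>
        obtain ⟨q, hq, h⟩ := ih k (by omega)
        refine ⟨q + 1, by omega, ?_⟩
        simpa [pullLen, add_assoc] using h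
    · simp only [if_neg hz, List.cons_append, List.nil_append, List.length_cons] at hk ⊢
      match k, hk with
      | 0, _ => exact ⟨0, by simp, by simp, by simp [pullLen, hz], Or.inl (by simp [pullLen, hz])⟩
      | k + 1, hk =>
        obtain ⟨q, hq, h⟩ := ih k (by omega)
        refine ⟨q + 1, by omega, ?_⟩
        simpa [pullLen, hz] using h

/-- `p` is the boundary whose image under `T` contains the boundary `b` of the transformed
equation. -/
structure Parent (U₁ U₂ U₁' U₂' : List X) (x y : X) (L : X → ℕ) (b p : ℕ × ℕ) : Prop where
  boundary : Boundary U₁ U₂ p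
  fst_eq : p.1 = b.1
  start_le : prefixLen U₁ U₂ (pullLen x y L) (p.1, p.2 - 1) ≤
    L y + prefixLen U₁' U₂' L (b.1, b.2 - 1)
  le_stop : L y + prefixLen U₁' U₂' L b ≤ prefixLen U₁ U₂ (pullLen x y L) p
  letter_eq : (letter U₁' U₂' b = letter U₁ U₂ p ∧
      prefixLen U₁ U₂ (pullLen x y L) p = L y + prefixLen U₁' U₂' L b) ∨
    (letter U₁' U₂' b = some y ∧ letter U₁ U₂ p = some x ∧
      prefixLen U₁ U₂ (pullLen x y L) (p.1, p.2 - 1) = L y + prefixLen U₁' U₂' L (b.1, b.2 - 1))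

section CaseII

variable {V₁ V₂ : List X} {x y : X}

theorem word_expand_tail (i : ℕ) :
    y :: word (expand x y (x :: V₁)).tail (expand x y (y :: V₂)).tail i =
      expand x y (word (x :: V₁) (y :: V₂) i) := by
  unfold word
  split
  · simp [expand_cons]
  · by_cases h : y = x <;> simp [expand_cons, h]

theorem Boundary.exists_parent (L : X → ℕ) {b : ℕ × ℕ}
    (hb : Boundary (expand x y (x :: V₁)).tail (expand x y (y :: V₂)).tail b) :
    ∃ p, Parent (x :: V₁) (y :: V₂) (expand x y (x :: V₁)).tail (expand x y (y :: V₂)).tail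
      x y L b p := by
  obtain ⟨i, j⟩ := b
  obtain ⟨hi, h1, h2⟩ := hb
  obtain ⟨j, rfl⟩ : ∃ m, j = m + 1 := ⟨j - 1, by simp at h1; omega⟩
  have hw := word_expand_tail (V₁ := V₁) (V₂ := V₂) (x := x) (y := y) i
  obtain ⟨q, hq, hs, he, hl⟩ := ExtWordEq.exists_parent x y L (word (x :: V₁) (y :: V₂) i) (j + 1)
    (by rw [← hw]; simpa using h2)
  rw [← hw] at hs he hl
  simp only [List.take_succ_cons, List.map_cons, List.sum_cons, List.getElem?_cons_succ] at hs he hl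
  exact ⟨(i, q + 1), ⟨hi, Nat.succ_pos q, hq⟩, rfl, hs, he, hl⟩

theorem prefixLen_mu (L : X → ℕ) {b : ℕ × ℕ} (hb : Boundary (x :: V₁) (y :: V₂) b) :
    L y + prefixLen (expand x y (x :: V₁)).tail (expand x y (y :: V₂)).tail L
      (mu (x :: V₁) (y :: V₂) x b) = prefixLen (x :: V₁) (y :: V₂) (pullLen x y L) b := by
  obtain ⟨i, j⟩ := b
  obtain ⟨-, h1, h2⟩ := hb
  have hw := word_expand_tail (V₁ := V₁) (V₂ := V₂) (x := x) (y := y) i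
  simp only at h1 h2
  simp only [prefixLen, mu]
  rw [← sum_map_expand, ← take_expand x y _ h2, ← hw]
  obtain ⟨m, hm⟩ : ∃ m, j + ((word (x :: V₁) (y :: V₂) i).take j).count x = m + 1 :=
    ⟨_, (Nat.sub_add_cancel (by omega)).symm⟩
  simp [hm]

theorem nu_mu (hxy : y ≠ x) {b : ℕ × ℕ} (hb : Boundary (x :: V₁) (y :: V₂) b) :
    nu (expand x y (x :: V₁)).tail (expand x y (y :: V₂)).tail x (mu (x :: V₁) (y :: V₂) x b) =
      b := by
  obtain ⟨i, j⟩ := b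
  obtain ⟨-, h1, h2⟩ := hb
  have hw := word_expand_tail (V₁ := V₁) (V₂ := V₂) (x := x) (y := y) i
  simp only at h1 h2
  have hc := count_expand hxy ((word (x :: V₁) (y :: V₂) i).take j)
  rw [← take_expand x y _ h2, ← hw] at hc
  simp only [nu, mu]
  obtain ⟨m, hm⟩ : ∃ m, j + ((word (x :: V₁) (y :: V₂) i).take j).count x = m + 1 :=
    ⟨_, (Nat.sub_add_cancel (by omega)).symm⟩
  rw [hm, List.take_succ_cons, List.count_cons_of_ne hxy] at hc
  rw [hm, Nat.add_sub_cancel, hc]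
  congr 1
  omega

theorem Bminus.boundary_mu {b : ℕ × ℕ} (hxy : y ≠ x) (hb : Bminus (x :: V₁) (y :: V₂) b) :
    Boundary (expand x y (x :: V₁)).tail (expand x y (y :: V₂)).tail
      (mu (x :: V₁) (y :: V₂) x b) := by
  have hpos : 0 < (mu (x :: V₁) (y :: V₂) x b).2 := by
    have h := prefixLen_mu (fun _ => 1) hb.1
    have hgt := hb.prefixLen_gt (L := pullLen x y fun _ => 1) (pullLen_pos fun _ => one_pos)
      (by simp [pullLen, hxy])
    rw [← h] at hgt
    by_contra h0
    have h0 : mu (x :: V₁) (y :: V₂) x b = (b.1, 0) := Prod.ext rfl (by omega)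
    rw [h0, prefixLen_zero] at hgt
    simp [pullLen, hxy] at hgt
  obtain ⟨⟨hi, h1, h2⟩, -⟩ := hb
  refine ⟨hi, hpos, ?_⟩
  have hw := congrArg List.length (word_expand_tail (V₁ := V₁) (V₂ := V₂) (x := x) (y := y) b.1)
  rw [length_expand, List.length_cons] at hw
  have hc := ((word (x :: V₁) (y :: V₂) b.1).take_sublist b.2).count_le x
  simp only [mu]
  omega

variable {lt lt' : BRel} {L : X → ℕ}

/-- If `L` measures the transformed equation, then its pullback along `T` measures the original
one. -/
theorem measures_pullLen (hxy : y ≠ x) (hbo : BoundaryOrder (x :: V₁) (y :: V₂) lt)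
    (hmin : ∀ b, Bminus (x :: V₁) (y :: V₂) b → lt (2, 1) b)
    (hL : ∀ z, 0 < L z)
    (hm : Measures (expand x y (x :: V₁)).tail (expand x y (y :: V₂)).tail lt' L)
    (hlt : ∀ a b, Bpminus (x :: V₁) (y :: V₂) x a → Bpminus (x :: V₁) (y :: V₂) x b →
      (lt' a b ↔ lt (nu (expand x y (x :: V₁)).tail (expand x y (y :: V₂)).tail x a)
        (nu (expand x y (x :: V₁)).tail (expand x y (y :: V₂)).tail x b))) :
    Measures (x :: V₁) (y :: V₂) lt (pullLen x y L) := by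
  have hyx : pullLen x y L y < pullLen x y L x := by simp [pullLen, hxy, hL x]
  refine hbo.measures (pullLen_pos hL) fun a b ha hb => ?_
  by_cases ha' : a = (2, 1) <;> by_cases hb' : b = (2, 1)
  · subst ha' hb'
    exact iff_of_false (hbo.irrefl _ ha.eBoundary) (Nat.lt_irrefl _)
  · subst ha'
    rw [prefixLen_two_one]
    exact iff_of_true (hmin b ⟨hb, hb'⟩) (Bminus.prefixLen_gt (pullLen_pos hL) hyx ⟨hb, hb'⟩)
  · subst hb'
    rw [prefixLen_two_one]
    exact iff_of_false
      (fun h => hbo.irrefl _ ha.eBoundary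
        (hbo.trans _ _ _ ha.eBoundary hb.eBoundary ha.eBoundary h (hmin a ⟨ha, ha'⟩)))
      (Bminus.prefixLen_gt (pullLen_pos hL) hyx ⟨ha, ha'⟩).not_gt
  · have key := hlt _ _ ⟨a, ⟨ha, ha'⟩, rfl⟩ ⟨b, ⟨hb, hb'⟩, rfl⟩
    rw [nu_mu hxy ha, nu_mu hxy hb, hm _ _ (Bminus.boundary_mu hxy ⟨ha, ha'⟩).eBoundary
      (Bminus.boundary_mu hxy ⟨hb, hb'⟩).eBoundary] at key
    rw [← key, ← prefixLen_mu L ha, ← prefixLen_mu L hb, Nat.add_lt_add_iff_left]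

theorem cuts_heads (hL : ∀ z, 0 < L z)
    (hm : Measures (x :: V₁) (y :: V₂) lt (pullLen x y L)) :
    Cuts (x :: V₁) (y :: V₂) lt (1, 1) (2, 1) ∧ Cuts (x :: V₁) (y :: V₂) lt (2, 1) (1, 1) := by
  have hx := pullLen_pos (x := x) (y := y) hL x
  have hy := pullLen_pos (x := x) (y := y) hL y
  rw [hm.cuts_iff one_one_boundary two_one_boundary, hm.cuts_iff two_one_boundary one_one_boundary]
  simp [prefixLen_one_one, prefixLen_two_one, prefixLen_zero, hx, hy]

/-- An edge of the cut graph of the transformed equation gives a path between the parents in the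
original cut graph, passing through `(1,1)` or `(2,1)` when an original `y` is mirrored with
a `y` created by the substitution. -/
theorem CutEdge.transGen_parent {U₁' U₂' : List X} (hxy : y ≠ x) (hL : ∀ z, 0 < L z)
    (hm : Measures (x :: V₁) (y :: V₂) lt (pullLen x y L)) (hm' : Measures U₁' U₂' lt' L)
    (hpar : ∀ c, Boundary U₁' U₂' c → ∃ r, Parent (x :: V₁) (y :: V₂) U₁' U₂' x y L c r)
    {a b p q : ℕ × ℕ} (hab : CutEdge U₁' U₂' lt' a b)
    (hp : Parent (x :: V₁) (y :: V₂) U₁' U₂' x y L a p)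
    (hq : Parent (x :: V₁) (y :: V₂) U₁' U₂' x y L b q) :
    Relation.TransGen (CutEdge (x :: V₁) (y :: V₂) lt) p q := by
  obtain ⟨c, hac, hcb⟩ := hab
  have ha := hac.1
  have hc := hac.2.1
  have hb := hcb.2.1
  obtain ⟨r, hr⟩ := hpar c hc
  obtain ⟨hside, h1, h2⟩ := (hm'.cuts_iff ha hc).1 hac
  obtain ⟨hlet, hne⟩ := (hm'.mirrors_iff hc hb).1 hcb
  obtain ⟨hcut₁, hcut₂⟩ := cuts_heads hL hm
  have hpr : Cuts (x :: V₁) (y :: V₂) lt p r := by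
    rw [hm.cuts_iff hp.boundary hr.boundary, hp.fst_eq, hr.fst_eq]
    have := hp.start_le; have := hp.le_stop; have := hr.start_le; have := hr.le_stop
    rw [hp.fst_eq] at *
    rw [hr.fst_eq] at *
    exact ⟨hside, by omega, by omega⟩
  have hx1 : letter (x :: V₁) (y :: V₂) (1, 1) = some x := rfl
  have hy1 : letter (x :: V₁) (y :: V₂) (2, 1) = some y := rfl
  have hTy : pullLen x y L y = L y := if_neg hxy
  have hLy := hL y
  have mirror_x : ∀ {s t : ℕ × ℕ}, Boundary (x :: V₁) (y :: V₂) s →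
      letter (x :: V₁) (y :: V₂) s = some x →
      prefixLen (x :: V₁) (y :: V₂) (pullLen x y L) (s.1, s.2 - 1) = L y + prefixLen U₁' U₂' L t →
      Mirrors (x :: V₁) (y :: V₂) lt s (1, 1) ∧ Mirrors (x :: V₁) (y :: V₂) lt (1, 1) s := by
    intro s t hs hsx hst
    rw [hm.mirrors_iff hs one_one_boundary, hm.mirrors_iff one_one_boundary hs, hsx, hx1,
      prefixLen_one_one]
    have := hs.prefixLen_eq (pullLen x y L) hsx
    exact ⟨⟨rfl, by omega⟩, rfl, by omega⟩
  have mirror_y : ∀ {s t : ℕ × ℕ}, Boundary (x :: V₁) (y :: V₂) s → Boundary U₁' U₂' t →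
      letter (x :: V₁) (y :: V₂) s = some y →
      prefixLen (x :: V₁) (y :: V₂) (pullLen x y L) s = L y + prefixLen U₁' U₂' L t →
      Mirrors (x :: V₁) (y :: V₂) lt s (2, 1) ∧ Mirrors (x :: V₁) (y :: V₂) lt (2, 1) s := by
    intro s t hs ht hsy hst
    rw [hm.mirrors_iff hs two_one_boundary, hm.mirrors_iff two_one_boundary hs, hsy, hy1,
      prefixLen_two_one]
    have := ht.prefixLen_pos hL
    exact ⟨⟨rfl, by omega⟩, rfl, by omega⟩
  rcases hr.letter_eq with ⟨hrl, hre⟩ | ⟨hcy, hrx, hrs⟩ <;>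
    rcases hq.letter_eq with ⟨hql, hqe⟩ | ⟨hby, hqx, hqs⟩
  · refine .single ⟨r, hpr, (hm.mirrors_iff hr.boundary hq.boundary).2 ⟨?_, by omega⟩⟩
    rw [← hrl, hlet, hql]
  · exact .head ⟨r, hpr, (mirror_y hr.boundary hc (by rw [← hrl, hlet, hby]) hre).1⟩
      (.single ⟨(1, 1), hcut₂, (mirror_x hq.boundary hqx hqs).2⟩)
  · exact .head ⟨r, hpr, (mirror_x hr.boundary hrx hrs).1⟩
      (.single ⟨(2, 1), hcut₁, (mirror_y hq.boundary hb (by rw [← hql, ← hlet, hcy]) hqe).2⟩)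
  · refine .single ⟨r, hpr, (hm.mirrors_iff hr.boundary hq.boundary).2 ⟨by rw [hrx, hqx], ?_⟩⟩
    have e1 := hr.boundary.prefixLen_eq (pullLen x y L) hrx
    have e2 := hq.boundary.prefixLen_eq (pullLen x y L) hqx
    have e3 := hc.prefixLen_eq L hcy
    have e4 := hb.prefixLen_eq L hby
    omega

end CaseII

/-- **Lemma.** A case II coherent extended Nielsen transformation preserves
acyclicity of the cut graph. -/
theorem acyclic_preserved_caseII (U₁ U₂ U₁' U₂' : List X) (lt lt' : BRel)
    (h₁ : U₁ ≠ []) (h₂ : U₂ ≠ []) (hbo : BoundaryOrder U₁ U₂ lt)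
    (hcoh : Coherent U₁ U₂ lt)
    (hII : NielsenII U₁ U₂ lt U₁' U₂' lt') (hcoh' : Coherent U₁' U₂' lt')
    (hacyc : Acyclic U₁ U₂ lt) :
    Acyclic U₁' U₂' lt' := by
  obtain ⟨x, y, hx, hy, h21, rfl, rfl, hbo', hlt⟩ := hII
  obtain ⟨V₁, rfl⟩ := List.head?_eq_some_iff.1 hx
  obtain ⟨V₂, rfl⟩ := List.head?_eq_some_iff.1 hy
  obtain ⟨K, hK, hKlt⟩ := hcoh
  obtain ⟨L, hL, hLlt⟩ := hcoh'
  have hKyx : K y < K x := by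
    rw [hKlt _ _ two_one_boundary one_one_boundary, prefixLen_one_one, prefixLen_two_one] at h21
    exact h21
  have hxy : y ≠ x := fun h => by simp [h] at hKyx
  have hm' := hbo'.measures hL hLlt
  have hmin : ∀ b, Bminus (x :: V₁) (y :: V₂) b → lt (2, 1) b := fun b hb => by
    rw [hKlt _ _ two_one_boundary hb.1, prefixLen_two_one]
    exact hb.prefixLen_gt hK hKyx
  have hm := measures_pullLen hxy hbo hmin hL hm' hlt
  rw [acyclic_iff_transGen] at hacyc ⊢
  have hpar : ∀ c, ∃ r, Boundary (expand x y (x :: V₁)).tail (expand x y (y :: V₂)).tail c →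
      Parent (x :: V₁) (y :: V₂) (expand x y (x :: V₁)).tail (expand x y (y :: V₂)).tail
        x y L c r := fun c => by
    by_cases hc : Boundary (expand x y (x :: V₁)).tail (expand x y (y :: V₂)).tail c
    · obtain ⟨r, hr⟩ := hc.exists_parent L
      exact ⟨r, fun _ => hr⟩
    · exact ⟨c, fun h => absurd h hc⟩
  choose f hf using hpar
  intro a haa
  refine hacyc (f a) (Relation.TransGen.lift' f (fun c d hcd => ?_) a a haa)
  obtain ⟨e, he, hed⟩ := id hcd
  exact hcd.transGen_parent hxy hL hm hm' (fun c hc => hc.exists_parent L)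
    (hf c he.1) (hf d hed.2.1)

end ExtWordEq
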